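/- Let V(r) = 1/r³ − (113/100)/r⁶ + (523/1000)/r⁹ and let f(t) = V(√(2 − 2t)) for t ∈ [−1,1). There exists a unique polynomial h of the form h(t) = α_0 + α_1 P_1(t) + α_2 P_2(t) + α_3 P_3(t) + α_5 P_5(t) (note: no P_4 term) satisfying the interpolation conditions h(1/3) = f(1/3), h'(1/3) = f'(1/3), h(−1/3) = f(−1/3), h'(−1/3) = f'(−1/3), and h(−1) = f(−1). Moreover this h has all coefficients α_0, α_1, α_2, α_3, α_5 positive, and h(t) ≤ f(t) for all t ∈ [−1,1), with equality if and only if t ∈ {−1, −1/3, 1/3}. -/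

import Mathlib

/-- The potential function of Theorem 2 (the cube theorem). -/
noncomputable def cubeV : ℝ → ℝ :=
  fun r => 1 / r ^ 3 - (113 / 100) / r ^ 6 + (523 / 1000) / r ^ 9

/-- The cube potential as a function of the inner product `t`: `f(t) = V(√(2-2t))`. -/
noncomputable def cubeF : ℝ → ℝ :=
  fun t => cubeV (Real.sqrt (2 - 2 * t))

/-- The candidate auxiliary polynomial with coefficients
`a = (α₀, α₁, α₂, α₃, α₅)` in the basis `P₀, P₁, P₂, P₃, P₅` of Legendre polynomials
(no `P₄` term). -/
noncomputable def cubeH (a : ℝ × ℝ × ℝ × ℝ × ℝ) : ℝ → ℝ :=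
  fun t => a.1 + a.2.1 * t + a.2.2.1 * ((3 * t ^ 2 - 1) / 2) +
    a.2.2.2.1 * ((5 * t ^ 3 - 3 * t) / 2) +
    a.2.2.2.2 * ((63 * t ^ 5 - 70 * t ^ 3 + 15 * t) / 8)

/-- The interpolation conditions: `h` agrees with `f` to order 2 at `t = ±1/3` and to
order 1 at `t = -1`. -/
def cubeInterpCond (a : ℝ × ℝ × ℝ × ℝ × ℝ) : Prop :=
  cubeH a (1 / 3) = cubeF (1 / 3) ∧ deriv (cubeH a) (1 / 3) = deriv cubeF (1 / 3) ∧
  cubeH a (-(1 / 3)) = cubeF (-(1 / 3)) ∧ deriv (cubeH a) (-(1 / 3)) = deriv cubeF (-(1 / 3)) ∧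
  cubeH a (-1) = cubeF (-1)

open Finset

/-- A real polynomial whose coefficients change sign once, from nonnegative to nonpositive, and
which is positive at `a > 0`, is positive on `(0, a]`. -/
theorem sum_mul_pow_pos_of_sign_change {n : ℕ} (c : Fin n → ℝ) (m : ℕ) {a x : ℝ}
    (hpos : ∀ i : Fin n, (i : ℕ) ≤ m → 0 ≤ c i) (hneg : ∀ i : Fin n, m < (i : ℕ) → c i ≤ 0)
    (hsum : 0 < ∑ i, c i * a ^ (i : ℕ)) (hx : 0 < x) (hxa : x ≤ a) :
    0 < ∑ i, c i * x ^ (i : ℕ) := by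
  have ha : 0 < a := hx.trans_le hxa
  have key : (∑ i, c i * a ^ (i : ℕ)) * x ^ m ≤ (∑ i, c i * x ^ (i : ℕ)) * a ^ m := by
    rw [sum_mul, sum_mul]
    refine sum_le_sum fun i _ => ?_
    rw [mul_assoc, mul_assoc]
    rcases le_or_gt (i : ℕ) m with hi | hi
    · refine mul_le_mul_of_nonneg_left ?_ (hpos i hi)
      obtain ⟨k, rfl⟩ := Nat.exists_eq_add_of_le hi
      have hk : x ^ k ≤ a ^ k := by gcongr
      calc a ^ (i : ℕ) * x ^ ((i : ℕ) + k) = a ^ (i : ℕ) * x ^ (i : ℕ) * x ^ k := by ring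
        _ ≤ a ^ (i : ℕ) * x ^ (i : ℕ) * a ^ k := by gcongr
        _ = x ^ (i : ℕ) * a ^ ((i : ℕ) + k) := by ring
    · refine mul_le_mul_of_nonpos_left ?_ (hneg i hi)
      obtain ⟨k, hk⟩ := Nat.exists_eq_add_of_le hi.le
      have hxk : x ^ k ≤ a ^ k := by gcongr
      rw [hk]
      calc x ^ (m + k) * a ^ m = a ^ m * x ^ m * x ^ k := by ring
        _ ≤ a ^ m * x ^ m * a ^ k := by gcongr
        _ = a ^ (m + k) * x ^ m := by ring
  exact pos_of_mul_pos_left ((mul_pos hsum (pow_pos hx m)).trans_le key) (pow_pos ha m).le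

theorem cubeV_eq_inv (r : ℝ) :
    cubeV r = r⁻¹ ^ 3 - 113 / 100 * r⁻¹ ^ 6 + 523 / 1000 * r⁻¹ ^ 9 := by
  simp only [cubeV, inv_pow]
  ring

theorem hasDerivAt_cubeF {t : ℝ} (ht : t < 1) :
    HasDerivAt cubeF (3 * (√(2 - 2 * t))⁻¹ ^ 5 - 6 * (113 / 100) * (√(2 - 2 * t))⁻¹ ^ 8 +
      9 * (523 / 1000) * (√(2 - 2 * t))⁻¹ ^ 11) t := by
  have hlin : HasDerivAt (fun t : ℝ => 2 - 2 * t) (-2) t := by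
    simpa using ((hasDerivAt_id t).const_mul 2).const_sub 2
  have hr : √(2 - 2 * t) ≠ 0 := (Real.sqrt_pos.2 (by linarith)).ne'
  have hu := (hlin.sqrt (by linarith)).fun_inv hr
  have hV := ((hu.fun_pow 3).fun_sub ((hu.fun_pow 6).const_mul (113 / 100))).fun_add
    ((hu.fun_pow 9).const_mul (523 / 1000))
  have hF : cubeF = fun t => (√(2 - 2 * t))⁻¹ ^ 3 - 113 / 100 * (√(2 - 2 * t))⁻¹ ^ 6 +
      523 / 1000 * (√(2 - 2 * t))⁻¹ ^ 9 := funext fun t => cubeV_eq_inv _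
  rw [hF]
  refine hV.congr_deriv ?_
  generalize √(2 - 2 * t) = r
  simp only [inv_pow, div_eq_mul_inv, mul_inv]
  ring

theorem deriv_cubeH (a : ℝ × ℝ × ℝ × ℝ × ℝ) (t : ℝ) :
    deriv (cubeH a) t = a.2.1 + a.2.2.1 * (3 * t) + a.2.2.2.1 * ((15 * t ^ 2 - 3) / 2) +
      a.2.2.2.2 * ((315 * t ^ 4 - 210 * t ^ 2 + 15) / 8) := by
  have hid := hasDerivAt_id' t
  have h1 := hid.const_mul a.2.1
  have h2 := (((((hasDerivAt_pow 2 t).const_mul 3).sub_const 1).div_const 2)).const_mul a.2.2.1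
  have h3 := ((((hasDerivAt_pow 3 t).const_mul 5).fun_sub (hid.const_mul 3)).div_const
    2).const_mul a.2.2.2.1
  have h5 := (((((hasDerivAt_pow 5 t).const_mul 63).fun_sub
    ((hasDerivAt_pow 3 t).const_mul 70)).fun_add (hid.const_mul 15)).div_const
    8).const_mul a.2.2.2.2
  have h := (((h1.const_add a.1).fun_add h2).fun_add h3).fun_add h5
  have hH : deriv (cubeH a) t = _ := h.deriv
  rw [hH]
  norm_num
  ring

theorem inv_sqrt_four_thirds : (√(2 - 2 * (1 / 3)) : ℝ)⁻¹ = √3 / 2 := by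
  have h3 : √3 ^ 2 = (3 : ℝ) := Real.sq_sqrt (by norm_num)
  have h : (√(2 - 2 * (1 / 3)) : ℝ) = 2 * √3 / 3 := by
    rw [Real.sqrt_eq_iff_mul_self_eq (by norm_num) (by positivity)]
    linear_combination -4 / 9 * h3
  rw [h]
  field_simp
  linear_combination -h3

theorem inv_sqrt_eight_thirds : (√(2 - 2 * (-(1 / 3))) : ℝ)⁻¹ = √6 / 4 := by
  have h6 : √6 ^ 2 = (6 : ℝ) := Real.sq_sqrt (by norm_num)
  have h : (√(2 - 2 * (-(1 / 3))) : ℝ) = 2 * √6 / 3 := by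
    rw [Real.sqrt_eq_iff_mul_self_eq (by norm_num) (by positivity)]
    linear_combination -4 / 9 * h6
  rw [h]
  field_simp
  linear_combination -2 * h6

theorem cubeF_one_third : cubeF (1 / 3) = -3051 / 6400 + 234363 / 512000 * √3 := by
  have h : √3 ^ 2 = (3 : ℝ) := Real.sq_sqrt (by norm_num)
  have h3 : √3 ^ 3 = 3 * √3 := by rw [pow_succ, h]
  have h6 : √3 ^ 6 = (27 : ℝ) := by rw [pow_mul _ 2 3, h]; norm_num
  have h9 : √3 ^ 9 = 81 * √3 := by rw [pow_succ, pow_mul _ 2 4, h]; norm_num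
  rw [cubeF, cubeV_eq_inv, inv_sqrt_four_thirds]
  simp only [div_pow, h3, h6, h9]
  ring

theorem deriv_cubeF_one_third :
    deriv cubeF (1 / 3) = -27459 / 12800 + 2871801 / 2048000 * √3 := by
  have h : √3 ^ 2 = (3 : ℝ) := Real.sq_sqrt (by norm_num)
  have h5 : √3 ^ 5 = 9 * √3 := by rw [pow_succ, pow_mul _ 2 2, h]; norm_num
  have h8 : √3 ^ 8 = (81 : ℝ) := by rw [pow_mul _ 2 4, h]; norm_num
  have h11 : √3 ^ 11 = 243 * √3 := by rw [pow_succ, pow_mul _ 2 5, h]; norm_num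
  rw [(hasDerivAt_cubeF (by norm_num)).deriv, inv_sqrt_four_thirds]
  simp only [div_pow, h5, h8, h11]
  ring

theorem cubeF_neg_one_third :
    cubeF (-(1 / 3)) = -3051 / 51200 + 1578363 / 16384000 * √6 := by
  have h : √6 ^ 2 = (6 : ℝ) := Real.sq_sqrt (by norm_num)
  have h3 : √6 ^ 3 = 6 * √6 := by rw [pow_succ, h]
  have h6 : √6 ^ 6 = (216 : ℝ) := by rw [pow_mul _ 2 3, h]; norm_num
  have h9 : √6 ^ 9 = 1296 * √6 := by rw [pow_succ, pow_mul _ 2 4, h]; norm_num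
  rw [cubeF, cubeV_eq_inv, inv_sqrt_eight_thirds]
  simp only [div_pow, h3, h6, h9]
  ring

theorem deriv_cubeF_neg_one_third :
    deriv cubeF (-(1 / 3)) = -27459 / 204800 + 14967801 / 131072000 * √6 := by
  have h : √6 ^ 2 = (6 : ℝ) := Real.sq_sqrt (by norm_num)
  have h5 : √6 ^ 5 = 36 * √6 := by rw [pow_succ, pow_mul _ 2 2, h]; norm_num
  have h8 : √6 ^ 8 = (1296 : ℝ) := by rw [pow_mul _ 2 4, h]; norm_num
  have h11 : √6 ^ 11 = 7776 * √6 := by rw [pow_succ, pow_mul _ 2 5, h]; norm_num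
  rw [(hasDerivAt_cubeF (by norm_num)).deriv, inv_sqrt_eight_thirds]
  simp only [div_pow, h5, h8, h11]
  ring

theorem cubeF_neg_one : cubeF (-1) = 55483 / 512000 := by
  have h : √(2 - 2 * (-1)) = (2 : ℝ) := by
    rw [Real.sqrt_eq_iff_mul_self_eq (by norm_num) (by norm_num)]
    norm_num
  rw [cubeF, h, cubeV]
  norm_num

/-- The coefficients `(α₀, α₁, α₂, α₃, α₅)` of the interpolant, with `√3` and `√6` replaced by
`p` and `q`. -/
noncomputable def cubeCoeffs (p q : ℝ) : ℝ × ℝ × ℝ × ℝ × ℝ :=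
  (
    -247131 / 409600 + 1894719 / 4096000 * p + 7637637 / 262144000 * q,
    -197986057 / 143360000 + 126395457 / 143360000 * p + 279517839 / 9175040000 * q,
    -82377 / 81920 + 2871801 / 4096000 * p - 14967801 / 262144000 * q,
    -2515041 / 5120000 + 4396869 / 20480000 * p + 68738733 / 1310720000 * q,
    4443273 / 28672000 + 482733 / 7168000 * p - 101724471 / 917504000 * q)

theorem cubeInterpCond_iff (a : ℝ × ℝ × ℝ × ℝ × ℝ) :
    cubeInterpCond a ↔ a = cubeCoeffs √3 √6 := by
  obtain ⟨a0, a1, a2, a3, a5⟩ := a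
  simp only [cubeInterpCond, deriv_cubeH, cubeF_one_third, deriv_cubeF_one_third,
    cubeF_neg_one_third, deriv_cubeF_neg_one_third, cubeF_neg_one, cubeH, cubeCoeffs,
    Prod.mk.injEq]
  constructor
  · rintro ⟨h1, h2, h3, h4, h5⟩
    refine ⟨?_, ?_, ?_, ?_, ?_⟩ <;> linarith
  · rintro ⟨rfl, rfl, rfl, rfl, rfl⟩
    refine ⟨?_, ?_, ?_, ?_, ?_⟩ <;> ring

/-- The coefficients, in powers of the distance `r`, of the cofactor of the interpolation nodes in
`r ^ 9 * (f - h)`, with `√3` and `√6` replaced by `p` and `q`. -/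
noncomputable def cubeCofactor (p q : ℝ) : Fin 15 → ℝ :=
  ![
    4707 / 64000,
    4707 / 128000 + 4707 / 64000 * p + 4707 / 128000 * q,
    136503 / 512000 + 4707 / 128000 * p + 4707 / 256000 * q + 4707 / 128000 * (p * q),
    -26217 / 1024000 + 108261 / 512000 * p + 61191 / 512000 * q + 4707 / 256000 * (p * q),
    70767 / 163840 - 54459 / 1024000 * p - 20169 / 1024000 * q + 4707 / 51200 * (p * q),
    -524853 / 1638400 + 1119609 / 4096000 * p + 1402029 / 8192000 * q - 3429 / 102400 * (p * q),
    18804087 / 32768000 - 2297511 / 8192000 * p - 2503251 / 16384000 * q +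
    837189 / 8192000 * (p * q),
    -44168553 / 65536000 + 12086433 / 32768000 * p + 7299 / 32768 * q -
    2091771 / 16384000 * (p * q),
    42521103 / 52428800 - 30383487 / 65536000 * p - 91647 / 327680 * q +
    4787433 / 32768000 * (p * q),
    -214355493 / 524288000 + 54289557 / 262144000 * p + 691738929 / 2097152000 * q -
    12054087 / 65536000 * (p * q),
    15928209 / 41943040 - 117851931 / 524288000 * p - 401023503 / 4194304000 * q +
    23750541 / 419430400 * (p * q),
    -16534611 / 419430400 + 76491441 / 524288000 * p - 158242419 / 8388608000 * q -
    165616767 / 4194304000 * (p * q),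
    157592547 / 2097152000 + 94264533 / 1048576000 * p - 442611891 / 16777216000 * q -
    164565531 / 4194304000 * (p * q),
    2540403 / 33554432 - 22019013 / 262144000 * p + 62411823 / 16777216000 * q +
    119803941 / 8388608000 * (p * q),
    -39989457 / 1048576000 - 4344597 / 262144000 * p + 915520239 / 33554432000 * q]

theorem cube_factorization {p q : ℝ} (hp : p ^ 2 = 3) (hq : q ^ 2 = 6) (r : ℝ) :
    r ^ 6 - 113 / 100 * r ^ 3 + 523 / 1000 - r ^ 9 * cubeH (cubeCoeffs p q) (1 - r ^ 2 / 2) =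
      (r - 2 * p / 3) ^ 2 * (r - 2 * q / 3) ^ 2 * (2 - r) *
        ∑ i, cubeCofactor p q i * r ^ (i : ℕ) := by
  have hp' : (r - 2 * p / 3) ^ 2 = r ^ 2 + 4 / 3 - 4 / 3 * r * p := by
    linear_combination 4 / 9 * hp
  have hq' : (r - 2 * q / 3) ^ 2 = r ^ 2 + 8 / 3 - 4 / 3 * r * q := by
    linear_combination 4 / 9 * hq
  obtain ⟨c₁, hc₁⟩ : ∃ c, c =
      4707 / 64000 * r + 4707 / 128000 * r ^ 2 + 108261 / 512000 * r ^ 3 -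
      54459 / 1024000 * r ^ 4 + 1119609 / 4096000 * r ^ 5 - 2297511 / 8192000 * r ^ 6 +
      12086433 / 32768000 * r ^ 7 - 30383487 / 65536000 * r ^ 8 + 54289557 / 262144000 * r ^ 9 -
      117851931 / 524288000 * r ^ 10 + 76491441 / 524288000 * r ^ 11 +
      94264533 / 1048576000 * r ^ 12 - 22019013 / 262144000 * r ^ 13 -
      4344597 / 262144000 * r ^ 14 := ⟨_, rfl⟩
  obtain ⟨c₂, hc₂⟩ : ∃ c, c =
      4707 / 128000 * r + 4707 / 256000 * r ^ 2 + 61191 / 512000 * r ^ 3 -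
      20169 / 1024000 * r ^ 4 + 1402029 / 8192000 * r ^ 5 - 2503251 / 16384000 * r ^ 6 +
      7299 / 32768 * r ^ 7 - 91647 / 327680 * r ^ 8 + 691738929 / 2097152000 * r ^ 9 -
      401023503 / 4194304000 * r ^ 10 - 158242419 / 8388608000 * r ^ 11 -
      442611891 / 16777216000 * r ^ 12 + 62411823 / 16777216000 * r ^ 13 +
      915520239 / 33554432000 * r ^ 14 := ⟨_, rfl⟩
  obtain ⟨c₃, hc₃⟩ : ∃ c, c =
      4707 / 128000 * r ^ 2 + 4707 / 256000 * r ^ 3 + 4707 / 51200 * r ^ 4 -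
      3429 / 102400 * r ^ 5 + 837189 / 8192000 * r ^ 6 - 2091771 / 16384000 * r ^ 7 +
      4787433 / 32768000 * r ^ 8 - 12054087 / 65536000 * r ^ 9 + 23750541 / 419430400 * r ^ 10 -
      165616767 / 4194304000 * r ^ 11 - 164565531 / 4194304000 * r ^ 12 +
      119803941 / 8388608000 * r ^ 13 := ⟨_, rfl⟩
  have hsum : ∑ i, cubeCofactor p q i * r ^ (i : ℕ) = (
      4707 / 64000 + 4707 / 128000 * r + 136503 / 512000 * r ^ 2 - 26217 / 1024000 * r ^ 3 +
      70767 / 163840 * r ^ 4 - 524853 / 1638400 * r ^ 5 + 18804087 / 32768000 * r ^ 6 -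
      44168553 / 65536000 * r ^ 7 + 42521103 / 52428800 * r ^ 8 - 214355493 / 524288000 * r ^ 9 +
      15928209 / 41943040 * r ^ 10 - 16534611 / 419430400 * r ^ 11 +
      157592547 / 2097152000 * r ^ 12 + 2540403 / 33554432 * r ^ 13 -
      39989457 / 1048576000 * r ^ 14) +
      c₁ * p + c₂ * q + c₃ * (p * q) := by
    simp only [cubeCofactor, Fin.sum_univ_succ, Matrix.cons_val_zero, Matrix.cons_val_succ,
      Fin.val_zero, Fin.val_succ, Finset.univ_eq_empty, Finset.sum_empty, hc₁, hc₂, hc₃]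
    ring
  rw [hp', hq', hsum]
  simp only [cubeH, cubeCoeffs]
  linear_combination (norm := skip)
    4 / 3 * r * (2 - r) * (r ^ 2 + 8 / 3 - 4 / 3 * r * q) * (c₁ + c₃ * q) * hp +
    4 / 3 * r * (2 - r) * ((r ^ 2 + 4 / 3) * c₂ - 4 * r * c₃ +
      ((r ^ 2 + 4 / 3) * c₃ - 4 / 3 * r * c₂) * p) * hq
  rw [hc₁, hc₂, hc₃]
  ring

theorem cube_sqrt_bounds :
    (1732050807568877 / 10 ^ 15 < √3 ∧ √3 < 1732050807568878 / 10 ^ 15) ∧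
    (2449489742783178 / 10 ^ 15 < √6 ∧ √6 < 2449489742783179 / 10 ^ 15) ∧
    (4242640687119285 / 10 ^ 15 < √3 * √6 ∧ √3 * √6 < (4242640687119286 / 10 ^ 15 : ℝ)) := by
  rw [← Real.sqrt_mul (by norm_num)]
  refine ⟨⟨?_, ?_⟩, ⟨?_, ?_⟩, ⟨?_, ?_⟩⟩ <;>
  first
  | (apply Real.lt_sqrt_of_sq_lt; norm_num)
  | (rw [Real.sqrt_lt' (by norm_num)]; norm_num)

theorem cubeCofactor_sum_pos {r : ℝ} (hr : 0 < r) (hr2 : r ≤ 2) :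
    0 < ∑ i, cubeCofactor √3 √6 i * r ^ (i : ℕ) := by
  obtain ⟨⟨hp, hp'⟩, ⟨hq, hq'⟩, ⟨hm, hm'⟩⟩ := cube_sqrt_bounds
  norm_num at hp hp' hq hq' hm hm'
  refine sum_mul_pow_pos_of_sign_change (cubeCofactor √3 √6) 6 ?_ ?_ ?_ hr hr2
  · intro i hi
    fin_cases i <;> simp [cubeCofactor] at hi ⊢ <;> linarith
  · intro i hi
    fin_cases i <;> simp [cubeCofactor] at hi ⊢ <;> linarith
  · simp only [cubeCofactor, Fin.sum_univ_succ, Matrix.cons_val_zero, Matrix.cons_val_succ,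
      Fin.val_zero, Fin.val_succ, Finset.univ_eq_empty, Finset.sum_empty]
    norm_num
    linarith

/-- There is a unique polynomial `h = α₀ + α₁P₁ + α₂P₂ + α₃P₃ + α₅P₅` interpolating
`f(t) = V(√(2-2t))` to order 2 at `±1/3` and order 1 at `-1`; its coefficients are all
positive, and `h ≤ f` on `[-1, 1)` with equality exactly at `t ∈ {-1, -1/3, 1/3}`. -/
theorem cube_auxiliary_polynomial :
    (∃! a : ℝ × ℝ × ℝ × ℝ × ℝ, cubeInterpCond a) ∧
    ∀ a : ℝ × ℝ × ℝ × ℝ × ℝ, cubeInterpCond a →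
      (0 < a.1 ∧ 0 < a.2.1 ∧ 0 < a.2.2.1 ∧ 0 < a.2.2.2.1 ∧ 0 < a.2.2.2.2) ∧
      ∀ t ∈ Set.Ico (-1 : ℝ) 1,
        cubeH a t ≤ cubeF t ∧
        (cubeH a t = cubeF t ↔ t = -1 ∨ t = -(1 / 3) ∨ t = 1 / 3) := by
  simp only [cubeInterpCond_iff]
  refine ⟨⟨_, rfl, fun _ h => h⟩, ?_⟩
  rintro a ha
  refine ⟨?_, ?_⟩
  · obtain ⟨⟨hp, hp'⟩, ⟨hq, hq'⟩, -⟩ := cube_sqrt_bounds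
    norm_num at hp hp' hq hq'
    rw [ha]
    refine ⟨?_, ?_, ?_, ?_, ?_⟩ <;> simp only [cubeCoeffs] <;> linarith
  rintro t ⟨ht, ht1⟩
  obtain ⟨h1, -, h2, -, h3⟩ := (cubeInterpCond_iff a).2 ha
  have hs3 : √3 ^ 2 = (3 : ℝ) := Real.sq_sqrt (by norm_num)
  have hs6 : √6 ^ 2 = (6 : ℝ) := Real.sq_sqrt (by norm_num)
  obtain ⟨r, hr⟩ : ∃ r, r = √(2 - 2 * t) := ⟨_, rfl⟩
  have hr0 : 0 < r := hr ▸ Real.sqrt_pos.2 (by linarith)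
  have hrt : r ^ 2 = 2 - 2 * t := hr ▸ Real.sq_sqrt (by linarith)
  have hr2 : r ≤ 2 := by nlinarith
  have hfac := cube_factorization hs3 hs6 r
  have hpos := cubeCofactor_sum_pos hr0 hr2
  rw [← ha, show 1 - r ^ 2 / 2 = t by linarith] at hfac
  have hV : r ^ 9 * cubeF t = r ^ 6 - 113 / 100 * r ^ 3 + 523 / 1000 := by
    rw [cubeF, ← hr, cubeV]
    field_simp
  have hdiff : r ^ 9 * (cubeF t - cubeH a t) = (r - 2 * √3 / 3) ^ 2 * (r - 2 * √6 / 3) ^ 2 *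
      (2 - r) * ∑ i, cubeCofactor √3 √6 i * r ^ (i : ℕ) := by
    rw [mul_sub, hV, hfac]
  refine ⟨?_, ?_, ?_⟩
  · have hnonneg : 0 ≤ r ^ 9 * (cubeF t - cubeH a t) := by
      rw [hdiff]
      have := sub_nonneg.2 hr2
      positivity
    exact sub_nonneg.1 (nonneg_of_mul_nonneg_right hnonneg (by positivity))
  · intro heq
    rw [heq, sub_self, mul_zero, eq_comm, mul_eq_zero, mul_eq_zero, mul_eq_zero,
      sq_eq_zero_iff, sq_eq_zero_iff] at hdiff
    rcases hdiff with ((h | h) | h) | h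
    · right; right
      rw [sub_eq_zero.1 h] at hrt
      linarith
    · right; left
      rw [sub_eq_zero.1 h] at hrt
      linarith
    · left
      rw [← sub_eq_zero.1 h] at hrt
      linarith
    · exact absurd h hpos.ne'
  · rintro (rfl | rfl | rfl)
    exacts [h3, h2, h1]
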